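/- There is no biholomorphic automorphism of the open bidisk 𝔻² (that is, a bijective holomorphic map Φ : 𝔻² → 𝔻² whose inverse is holomorphic) such that Φ({(z, z²) : z ∈ 𝔻}) = {(z, z³) : z ∈ 𝔻}. -/

import Mathlib

/-- The open bidisk `𝔻² ⊆ ℂ²`. -/
def openBidisk : Set (ℂ × ℂ) := {p : ℂ × ℂ | ‖p.1‖ < 1 ∧ ‖p.2‖ < 1}

open Metric Set Filter Topology

/-- The disc automorphism `z ↦ (z - a) / (1 - \bar a z)`. -/
noncomputable def moebius (a z : ℂ) : ℂ := (z - a) / (1 - (starRingEnd ℂ) a * z)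

theorem moebius_denom_ne_zero {a z : ℂ} (ha : ‖a‖ < 1) (hz : ‖z‖ < 1) :
    1 - (starRingEnd ℂ) a * z ≠ 0 := by
  intro h
  have h1 : ‖(starRingEnd ℂ) a * z‖ = 1 := by rw [← sub_eq_zero.mp h]; simp
  rw [norm_mul, RCLike.norm_conj] at h1
  nlinarith [norm_nonneg a, norm_nonneg z]

theorem norm_moebius_lt_one {a z : ℂ} (ha : ‖a‖ < 1) (hz : ‖z‖ < 1) : ‖moebius a z‖ < 1 := by
  have h0 := norm_pos_iff.mpr (moebius_denom_ne_zero ha hz)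
  rw [moebius, norm_div, div_lt_one h0]
  refine lt_of_pow_lt_pow_left₀ 2 h0.le ?_
  have h2 : ‖1 - (starRingEnd ℂ) a * z‖ ^ 2 - ‖z - a‖ ^ 2 = (1 - ‖a‖ ^ 2) * (1 - ‖z‖ ^ 2) := by
    simp only [Complex.sq_norm, Complex.normSq_apply, Complex.sub_re, Complex.sub_im,
      Complex.mul_re, Complex.mul_im, Complex.conj_re, Complex.conj_im, Complex.one_re,
      Complex.one_im]
    ring
  have h3 : 0 < (1 - ‖a‖ ^ 2) * (1 - ‖z‖ ^ 2) := by
    apply mul_pos <;> nlinarith [norm_nonneg a, norm_nonneg z]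
  linarith

theorem moebius_neg_moebius {a z : ℂ} (ha : ‖a‖ < 1) (hz : ‖z‖ < 1) :
    moebius (-a) (moebius a z) = z := by
  have h1 := moebius_denom_ne_zero ha hz
  have h2 := moebius_denom_ne_zero (a := -a) (by simpa using ha) (norm_moebius_lt_one ha hz)
  rw [moebius, div_eq_iff h2]
  simp only [moebius, map_neg]
  generalize (starRingEnd ℂ) a = c at h1
  have h3 : 1 - z * c ≠ 0 := by rwa [mul_comm]
  field_simp
  ring

theorem moebius_self (a : ℂ) : moebius a a = 0 := by simp [moebius]

theorem moebius_apply_zero (a : ℂ) : moebius a 0 = -a := by simp [moebius]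

theorem moebius_zero (z : ℂ) : moebius 0 z = z := by simp [moebius]

theorem differentiableOn_moebius {a : ℂ} (ha : ‖a‖ < 1) :
    DifferentiableOn ℂ (moebius a) (ball 0 1) := by
  unfold moebius
  refine DifferentiableOn.div (by fun_prop) (by fun_prop) fun z hz => ?_
  exact moebius_denom_ne_zero ha (by simpa using hz)

theorem mem_ball_prod_iff {z w : ℂ} : (z, w) ∈ ball (0 : ℂ × ℂ) 1 ↔ ‖z‖ < 1 ∧ ‖w‖ < 1 := by
  simp [Prod.norm_def]

theorem norm_hasDerivAt_eq_one {g : ℂ → ℂ} {g' : ℂ} (hg : HasDerivAt g g' 0)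
    (h : ∀ z, ‖z‖ < 1 → ‖g z‖ = ‖z‖) : ‖g'‖ = 1 := by
  have h0 : g 0 = 0 := norm_eq_zero.mp (by simpa using h 0 (by simp))
  have ht := (hasDerivAt_iff_tendsto_slope_zero.mp hg).norm
  refine tendsto_nhds_unique (ht.congr' ?_) tendsto_const_nhds
  filter_upwards [self_mem_nhdsWithin, mem_nhdsWithin_of_mem_nhds (ball_mem_nhds (0 : ℂ) one_pos)]
    with z hz hz1
  have hz' : ‖z‖ ≠ 0 := norm_ne_zero_iff.mpr hz
  simp [h0, h z (by simpa using hz1), hz']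

/-- Equality in the Schwarz lemma on the bidisk in the direction `(1, 0)` forces the function to be
linear in the first coordinate. -/
theorem eq_mul_fst_of_norm_fderiv_eq_one {f : ℂ × ℂ → ℂ} (hd : DifferentiableOn ℂ f (ball 0 1))
    (hm : MapsTo f (ball 0 1) (ball 0 1)) (h0 : f 0 = 0) (h1 : ‖fderiv ℂ f 0 (1, 0)‖ = 1)
    {z w : ℂ} (hz : ‖z‖ < 1) (hw : ‖w‖ < 1) : f (z, w) = fderiv ℂ f 0 (1, 0) * z := by
  set L := fderiv ℂ f 0
  set α := L (1, 0) with hα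
  have hm' : MapsTo f (ball 0 1) (closedBall (f 0) 1) := by
    rw [h0]; exact hm.mono_right ball_subset_closedBall
  have hLn : ‖L‖ ≤ 1 := Complex.norm_fderiv_le_one_of_mapsTo_ball hd hm' one_pos
  have hfL : HasFDerivAt f L 0 := (hd.differentiableAt (ball_mem_nhds _ one_pos)).hasFDerivAt
  have hβ : L (0, 1) = 0 := by
    by_contra hβ
    set β := L (0, 1) with hβd
    have hβn : (‖β‖ : ℂ) ≠ 0 := by exact_mod_cast norm_ne_zero_iff.mpr hβ
    set u : ℂ := α * (starRingEnd ℂ) β / ‖β‖ with hu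
    have hun : ‖u‖ = 1 := by
      simp [hu, h1, norm_ne_zero_iff.mpr hβ]
    have hLu : L (1, u) = α * (1 + ‖β‖) := by
      have : ((1 : ℂ), u) = (1, 0) + u • ((0 : ℂ), (1 : ℂ)) := by simp
      rw [this, map_add, map_smul, ← hα, ← hβd, smul_eq_mul, hu]
      have h2 : (starRingEnd ℂ) β * β = (‖β‖ : ℂ) ^ 2 := Complex.conj_mul' β
      field_simp
      linear_combination α * h2
    have h3 : ‖L (1, u)‖ ≤ 1 := by
      refine (L.le_opNorm _).trans ?_
      simpa [Prod.norm_def, hun] using hLn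
    rw [hLu, norm_mul, h1, one_mul] at h3
    have h4 : ‖(1 : ℂ) + ‖β‖‖ = 1 + ‖β‖ := by
      rw [← Complex.ofReal_one, ← Complex.ofReal_add, Complex.norm_real, Real.norm_of_nonneg
        (by positivity)]
    rw [h4] at h3
    exact hβ (norm_le_zero_iff.mp (by linarith))
  have key : ∀ z u : ℂ, ‖z‖ < 1 → ‖u‖ ≤ 1 → f (z, z * u) = α * z := by
    intro z u hz hu
    have hball : MapsTo (fun t : ℂ => (t, t * u)) (ball 0 1) (ball 0 1) := by
      intro t ht
      rw [mem_ball_zero_iff] at ht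
      rw [mem_ball_prod_iff, norm_mul]
      exact ⟨ht, by nlinarith [norm_nonneg t, norm_nonneg u]⟩
    have hgd : DifferentiableOn ℂ (fun t : ℂ => f (t, t * u)) (ball 0 1) :=
      hd.comp (by fun_prop) hball
    have hder : HasDerivAt (fun t : ℂ => f (t, t * u)) α 0 := by
      have hc : HasDerivAt (fun t : ℂ => (t, t * u)) ((1 : ℂ), u) 0 := by
        simpa using (hasDerivAt_id (0 : ℂ)).prodMk ((hasDerivAt_id (0 : ℂ)).mul_const u)
      have hfL' : HasFDerivAt f L ((fun t : ℂ => (t, t * u)) 0) := by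
        simpa only [zero_mul, Prod.mk_zero_zero] using hfL
      have := hfL'.comp_hasDerivAt (0 : ℂ) hc
      have h2 : L (1, u) = α := by
        have : ((1 : ℂ), u) = (1, 0) + u • ((0 : ℂ), (1 : ℂ)) := by simp
        rw [this, map_add, map_smul, hβ]; simp [hα]
      rw [h2] at this
      exact this
    have hf00 : f (0, 0) = 0 := h0
    have := Complex.affine_of_mapsTo_ball_of_norm_dslope_eq_div (z₀ := 0) (R₂ := 1) hgd
      (by
        simp only [zero_mul, hf00]
        exact fun t ht => ball_subset_closedBall (hm (hball ht)))
      (mem_ball_self one_pos) (by rw [dslope_same, hder.deriv]; simpa using h1)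
      (mem_ball_zero_iff.mpr hz)
    simpa only [zero_mul, hf00, dslope_same, hder.deriv, zero_add, sub_zero, smul_eq_mul,
      mul_comm z α] using this
  have hball : MapsTo (fun t : ℂ => (t, w)) (ball 0 1) (ball 0 1) := fun t ht =>
    mem_ball_prod_iff.mpr ⟨mem_ball_zero_iff.mp ht, hw⟩
  have hgd : DifferentiableOn ℂ (fun t : ℂ => f (t, w)) (ball 0 1) := hd.comp (by fun_prop) hball
  have hld : DifferentiableOn ℂ (fun t : ℂ => α * t) (ball 0 1) := by fun_prop
  set c : ℂ := (((1 + ‖w‖) / 2 : ℝ) : ℂ) with hc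
  have hcn : ‖c‖ = (1 + ‖w‖) / 2 := by
    rw [hc, Complex.norm_real, Real.norm_of_nonneg (by positivity)]
  have hev : (fun t : ℂ => f (t, w)) =ᶠ[𝓝 c] fun t => α * t := by
    have h2 : ∀ᶠ t in 𝓝 c, ‖w‖ < ‖t‖ :=
      continuous_norm.continuousAt.eventually_const_lt (by simp only [hcn]; linarith)
    have h3 : ∀ᶠ t in 𝓝 c, ‖t‖ < 1 :=
      continuous_norm.continuousAt.eventually_lt_const (by simp only [hcn]; linarith)
    filter_upwards [h2, h3] with t ht1 ht2
    have htp : 0 < ‖t‖ := (norm_nonneg w).trans_lt ht1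
    have := key t (w / t) ht2 (by rw [norm_div, div_le_one htp]; exact ht1.le)
    rwa [mul_div_cancel₀ _ (norm_pos_iff.mp htp)] at this
  exact (hgd.analyticOnNhd isOpen_ball).eqOn_of_preconnected_of_eventuallyEq
    (hld.analyticOnNhd isOpen_ball) (convex_ball _ _).isPreconnected
    (mem_ball_zero_iff.mpr (by rw [hcn]; linarith)) hev (mem_ball_zero_iff.mpr hz)

/-- An automorphism of the bidisk fixing the origin, whose first component is norm preserving along
the parabola, is diagonal. -/
theorem exists_eq_diagonal {F G : ℂ × ℂ → ℂ × ℂ} (hF : MapsTo F (ball 0 1) (ball 0 1))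
    (hG : MapsTo G (ball 0 1) (ball 0 1)) (hFd : DifferentiableOn ℂ F (ball 0 1))
    (hGd : DifferentiableOn ℂ G (ball 0 1)) (hGF : ∀ p ∈ ball (0 : ℂ × ℂ) 1, G (F p) = p)
    (hF0 : F 0 = 0) (hpar : ∀ z : ℂ, ‖z‖ < 1 → ‖(F (z, z ^ 2)).1‖ = ‖z‖) :
    ∃ α γ : ℂ, ‖α‖ = 1 ∧ ‖γ‖ = 1 ∧ ∀ z w : ℂ, ‖z‖ < 1 → ‖w‖ < 1 → F (z, w) = (α * z, γ * w) := by
  have hG0 : G 0 = 0 := by simpa [hF0] using hGF 0 (mem_ball_self one_pos)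
  have hnorm : ∀ p ∈ ball (0 : ℂ × ℂ) 1, ‖F p‖ = ‖p‖ := by
    intro p hp
    refine le_antisymm ?_ ?_
    · exact Complex.norm_le_norm_of_mapsTo_ball hFd (hF.mono_right ball_subset_closedBall) hF0
        (mem_ball_zero_iff.mp hp)
    · have := Complex.norm_le_norm_of_mapsTo_ball hGd (hG.mono_right ball_subset_closedBall) hG0
        (mem_ball_zero_iff.mp (hF hp))
      rwa [hGF p hp] at this
  have hF00 : F (0, 0) = 0 := hF0
  have h1d : DifferentiableOn ℂ (fun p => (F p).1) (ball 0 1) := hFd.fst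
  have h1m : MapsTo (fun p => (F p).1) (ball 0 1) (ball 0 1) := fun p hp =>
    mem_ball_zero_iff.mpr (mem_ball_prod_iff.mp (hF hp)).1
  have hα : ‖fderiv ℂ (fun p => (F p).1) 0 (1, 0)‖ = 1 := by
    have hc : HasDerivAt (fun t : ℂ => (t, t ^ 2)) ((1 : ℂ), (0 : ℂ)) 0 := by
      simpa using (hasDerivAt_id (0 : ℂ)).prodMk ((hasDerivAt_id (0 : ℂ)).pow 2)
    have hf : HasFDerivAt (fun p => (F p).1) (fderiv ℂ (fun p => (F p).1) 0)
        ((fun t : ℂ => (t, t ^ 2)) 0) := by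
      simpa only [ne_eq, two_ne_zero, not_false_eq_true, zero_pow, Prod.mk_zero_zero] using
        (h1d.differentiableAt (ball_mem_nhds _ one_pos)).hasFDerivAt
    exact norm_hasDerivAt_eq_one (g := fun t => (F (t, t ^ 2)).1)
      (HasFDerivAt.comp_hasDerivAt (f := fun t : ℂ => (t, t ^ 2)) (0 : ℂ) hf hc) hpar
  have hfst : ∀ z w : ℂ, ‖z‖ < 1 → ‖w‖ < 1 → (F (z, w)).1 = _ := fun z w hz hw =>
    eq_mul_fst_of_norm_fderiv_eq_one h1d h1m (by simp [hF0]) hα hz hw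
  have hsw : MapsTo (Prod.swap : ℂ × ℂ → ℂ × ℂ) (ball 0 1) (ball 0 1) := fun ⟨z, w⟩ hp =>
    mem_ball_prod_iff.mpr (mem_ball_prod_iff.mp hp).symm
  have h2d : DifferentiableOn ℂ (fun p : ℂ × ℂ => (F p.swap).2) (ball 0 1) :=
    (hFd.comp (differentiable_snd.prodMk differentiable_fst).differentiableOn hsw).snd
  have h2m : MapsTo (fun p : ℂ × ℂ => (F p.swap).2) (ball 0 1) (ball 0 1) := fun p hp =>
    mem_ball_zero_iff.mpr (mem_ball_prod_iff.mp (hF (hsw hp))).2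
  have hγ : ‖fderiv ℂ (fun p : ℂ × ℂ => (F p.swap).2) 0 (1, 0)‖ = 1 := by
    have hc : HasDerivAt (fun t : ℂ => (t, (0 : ℂ))) ((1 : ℂ), (0 : ℂ)) 0 :=
      (hasDerivAt_id (0 : ℂ)).prodMk (hasDerivAt_const _ _)
    have hf : HasFDerivAt (fun p : ℂ × ℂ => (F p.swap).2)
        (fderiv ℂ (fun p : ℂ × ℂ => (F p.swap).2) 0) ((fun t : ℂ => (t, (0 : ℂ))) 0) :=
      (h2d.differentiableAt (ball_mem_nhds _ one_pos)).hasFDerivAt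
    refine norm_hasDerivAt_eq_one (g := fun t => (F (0, t)).2)
      (HasFDerivAt.comp_hasDerivAt (f := fun t : ℂ => (t, (0 : ℂ))) (0 : ℂ) hf hc) fun w hw => ?_
    have h3 := hnorm (0, w) (mem_ball_prod_iff.mpr ⟨by simp, hw⟩)
    rw [Prod.norm_def, hfst 0 w (by simp) hw] at h3
    simpa [Prod.norm_def] using h3
  refine ⟨_, _, hα, hγ, fun z w hz hw => Prod.ext (hfst z w hz hw) ?_⟩
  exact eq_mul_fst_of_norm_fderiv_eq_one h2d h2m (congrArg Prod.snd hF00) hγ hw hz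

theorem openBidisk_eq_ball : openBidisk = ball (0 : ℂ × ℂ) 1 := by
  ext ⟨z, w⟩
  exact mem_ball_prod_iff.symm

/-- There is no biholomorphic automorphism of the open bidisk mapping the
variety `{(z, z²) : z ∈ 𝔻}` onto the variety `{(z, z³) : z ∈ 𝔻}`. -/
theorem no_bidisk_automorphism_maps_parabola_to_cubic :
    ¬ ∃ Φ Ψ : ℂ × ℂ → ℂ × ℂ,
      Set.MapsTo Φ openBidisk openBidisk ∧ Set.MapsTo Ψ openBidisk openBidisk ∧
      DifferentiableOn ℂ Φ openBidisk ∧ DifferentiableOn ℂ Ψ openBidisk ∧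
      (∀ p ∈ openBidisk, Ψ (Φ p) = p) ∧ (∀ p ∈ openBidisk, Φ (Ψ p) = p) ∧
      Φ '' {p : ℂ × ℂ | ∃ z : ℂ, ‖z‖ < 1 ∧ p = (z, z ^ 2)} =
        {p : ℂ × ℂ | ∃ z : ℂ, ‖z‖ < 1 ∧ p = (z, z ^ 3)} := by
  rintro ⟨Φ, Ψ, hΦ, hΨ, hΦd, hΨd, hΨΦ, -, himg⟩
  rw [openBidisk_eq_ball] at hΦ hΨ hΦd hΨd hΨΦ
  have hpar : ∀ z : ℂ, ‖z‖ < 1 → ∃ s : ℂ, ‖s‖ < 1 ∧ Φ (z, z ^ 2) = (s, s ^ 3) := fun z hz =>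
    himg.subset (mem_image_of_mem Φ ⟨z, hz, rfl⟩)
  have hcub : ∀ s : ℂ, ‖s‖ < 1 → ∃ z : ℂ, ‖z‖ < 1 ∧ Φ (z, z ^ 2) = (s, s ^ 3) := by
    intro s hs
    obtain ⟨p, ⟨z, hz, rfl⟩, hp⟩ := himg.superset ⟨s, hs, rfl⟩
    exact ⟨z, hz, hp⟩
  have hpow : ∀ (n : ℕ), n ≠ 0 → ∀ z : ℂ, ‖z‖ < 1 → ‖z ^ n‖ < 1 := fun n hn z hz => by
    rw [norm_pow]; exact pow_lt_one₀ (norm_nonneg z) hz hn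
  have hparmem : ∀ z : ℂ, ‖z‖ < 1 → (z, z ^ 2) ∈ ball (0 : ℂ × ℂ) 1 := fun z hz =>
    mem_ball_prod_iff.mpr ⟨hz, hpow 2 two_ne_zero z hz⟩
  obtain ⟨a, ha, hΦ0⟩ := hpar 0 (by simp)
  have hb : ‖a ^ 3‖ < 1 := hpow 3 three_ne_zero a ha
  rw [zero_pow two_ne_zero] at hΦ0
  have hΦ0' : Φ 0 = (a, a ^ 3) := hΦ0
  have hMd : ∀ c d : ℂ, ‖c‖ < 1 → ‖d‖ < 1 →
      DifferentiableOn ℂ (fun p : ℂ × ℂ => (moebius c p.1, moebius d p.2)) (ball 0 1) := by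
    intro c d hc hd
    refine DifferentiableOn.prodMk ?_ ?_
    · exact (differentiableOn_moebius hc).comp differentiable_fst.differentiableOn
        fun p hp => mem_ball_zero_iff.mpr (mem_ball_prod_iff.mp hp).1
    · exact (differentiableOn_moebius hd).comp differentiable_snd.differentiableOn
        fun p hp => mem_ball_zero_iff.mpr (mem_ball_prod_iff.mp hp).2
  have hMm : ∀ c d : ℂ, ‖c‖ < 1 → ‖d‖ < 1 →
      MapsTo (fun p : ℂ × ℂ => (moebius c p.1, moebius d p.2)) (ball 0 1) (ball 0 1) :=
    fun c d hc hd p hp => mem_ball_prod_iff.mpr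
      ⟨norm_moebius_lt_one hc (mem_ball_prod_iff.mp hp).1,
        norm_moebius_lt_one hd (mem_ball_prod_iff.mp hp).2⟩
  have hna : ‖-a‖ < 1 := by rwa [norm_neg]
  have hnb : ‖-a ^ 3‖ < 1 := by rwa [norm_neg]
  have hFd := (hMd a (a ^ 3) ha hb).comp hΦd hΦ
  have hFm := (hMm a (a ^ 3) ha hb).comp hΦ
  have hF0 : ((fun p : ℂ × ℂ => (moebius a p.1, moebius (a ^ 3) p.2)) ∘ Φ) 0 = 0 := by
    simp [hΦ0', moebius_self]
  have hschwarz : ∀ z s : ℂ, ‖z‖ < 1 → ‖s‖ < 1 → Φ (z, z ^ 2) = (s, s ^ 3) →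
      ‖moebius a s‖ = ‖z‖ := by
    intro z s hz hs hzs
    refine le_antisymm ?_ ?_
    · have hm : MapsTo (fun t : ℂ => (t, t ^ 2)) (ball 0 1) (ball 0 1) := fun t ht =>
        hparmem t (mem_ball_zero_iff.mp ht)
      have hd := (hFd.comp (f := fun t : ℂ => (t, t ^ 2)) (by fun_prop) hm).fst
      have := Complex.norm_le_norm_of_mapsTo_ball hd (fun t ht => ball_subset_closedBall
        (mem_ball_zero_iff.mpr (mem_ball_prod_iff.mp (hFm (hm ht))).1))
        (by simp [hΦ0, moebius_self]) hz
      simpa [hzs] using this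
    · have hm : MapsTo (fun u : ℂ => (moebius (-a) u, moebius (-a) u ^ 3)) (ball 0 1)
          (ball 0 1) := fun t ht => by
        have := norm_moebius_lt_one hna (mem_ball_zero_iff.mp ht)
        exact mem_ball_prod_iff.mpr ⟨this, hpow 3 three_ne_zero _ this⟩
      have hmd : DifferentiableOn ℂ (fun u : ℂ => (moebius (-a) u, moebius (-a) u ^ 3))
          (ball 0 1) :=
        (differentiableOn_moebius hna).prodMk ((differentiableOn_moebius hna).pow 3)
      have h0 : Ψ (a, a ^ 3) = 0 := by rw [← hΦ0']; exact hΨΦ 0 (mem_ball_self one_pos)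
      have := Complex.norm_le_norm_of_mapsTo_ball (hΨd.comp hmd hm).fst
        (fun t ht => ball_subset_closedBall
          (mem_ball_zero_iff.mpr (mem_ball_prod_iff.mp (hΨ (hm ht))).1))
        (by simp [moebius_apply_zero, h0]) (norm_moebius_lt_one ha hs)
      simpa [moebius_neg_moebius ha hs, ← hzs, hΨΦ _ (hparmem z hz)] using this
  obtain ⟨α, γ, hα, hγ, hdiag⟩ := exists_eq_diagonal hFm (hΨ.comp (hMm (-a) (-a ^ 3) hna hnb)) hFd
    (hΨd.comp (hMd (-a) (-a ^ 3) hna hnb) (hMm (-a) (-a ^ 3) hna hnb))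
    (fun p hp => by
      have hq := mem_ball_prod_iff.mp (hΦ hp)
      simp [moebius_neg_moebius ha hq.1, moebius_neg_moebius hb hq.2, hΨΦ p hp])
    hF0
    (fun z hz => by
      obtain ⟨s, hs, hzs⟩ := hpar z hz
      simpa [hzs] using hschwarz z s hz hs hzs)
  have hcoord : ∀ z s : ℂ, ‖z‖ < 1 → Φ (z, z ^ 2) = (s, s ^ 3) →
      moebius a s = α * z ∧ moebius (a ^ 3) (s ^ 3) = γ * z ^ 2 := by
    intro z s hz hzs
    have := hdiag z (z ^ 2) hz (hpow 2 two_ne_zero z hz)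
    simpa [hzs, Prod.ext_iff] using this
  have ha0 : a = 0 := by
    obtain ⟨z, hz, hz0⟩ := hcub 0 (by simp)
    have hz' : ‖-z‖ < 1 := by rwa [norm_neg]
    obtain ⟨s, hs, hzs⟩ := hpar (-z) hz'
    obtain ⟨h1, h2⟩ := hcoord z 0 hz hz0
    obtain ⟨h3, h4⟩ := hcoord (-z) s hz' hzs
    have h5 : s ^ 3 = 0 ^ 3 := by
      rw [← moebius_neg_moebius hb (hpow 3 three_ne_zero s hs), h4, neg_sq, ← h2,
        moebius_neg_moebius hb (by simp)]
    have h6 : s = 0 := by simpa using h5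
    rw [h6] at h3
    rw [moebius_apply_zero] at h1 h3
    linear_combination (-1 / 2 : ℂ) * h1 - (1 / 2 : ℂ) * h3
  have hhalf : ‖(1 / 2 : ℂ)‖ = 1 / 2 := by norm_num
  obtain ⟨s, hs, hzs⟩ := hpar (1 / 2) (by rw [hhalf]; norm_num)
  obtain ⟨h1, h2⟩ := hcoord (1 / 2) s (by rw [hhalf]; norm_num) hzs
  rw [ha0, moebius_zero] at h1
  rw [ha0, zero_pow three_ne_zero, moebius_zero, h1] at h2
  have h3 := congrArg norm h2
  rw [norm_pow, norm_mul, norm_mul, norm_pow, hα, hγ, hhalf] at h3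
  norm_num at h3
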